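/- Suppose in addition F(u) > 0 for all u ∈ U (so ν = 1). Then the system (E0)–(Ek) holds on U if and only if there exist real constants b_0, …, b_{n−1} such that, with b_n := ε·((n−1)/(n−2))^{1−n}, A_n := 0, A_k(u) := Σ_{i=1}^{n−k} (−1)^i·binom(k+i, i)·a^i·b_{k+i}·(F(u))^{i(n−1)/(n−2)} for 0 ≤ k ≤ n−1, and B_k := A_k for 2 ≤ k ≤ n, B_1(u) := A_1(u) − a·(F(u))^{(n−1)/(n−2)}, B_0(u) := A_0(u) + a²·(F(u))^{2(n−1)/(n−2)}, for all u ∈ U: f_k(u) = (b_k + B_k(u))·((n−1)/(n−2))^{k−1}·(F(u))^{(k−n)/(n−2)}·(F'(u))^{k−1} for each 0 ≤ k ≤ n with k ≠ 2, and f_2(u) = (b_2 + B_2(u))·((n−1)/(n−2))·(F'(u)/F(u)) + F'(u)/F(u) − F''(u)/F'(u). -/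

import Mathlib

/-- The function `g = ((n−2)F)/((n−1)F')`. -/
noncomputable def gFun (n : ℕ) (F : ℝ → ℝ) (u : ℝ) : ℝ :=
  (((n : ℝ) - 2) * F u) / (((n : ℝ) - 1) * deriv F u)

/-- The system (E0)-(Ek) of equations on `U`. -/
def Esys (n : ℕ) (f : ℕ → ℝ → ℝ) (a : ℝ) (U : Set ℝ) (g : ℝ → ℝ) : Prop :=
  (∀ u ∈ U, -a ^ 2 * g u + deriv (f 0) u * g u + a * f 1 u * g u
      - f 0 u * deriv g u + 2 * f 0 u = 0) ∧
  (∀ u ∈ U, a * (1 - 2 * deriv g u) + deriv (f 1) u * g u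
      + 2 * a * f 2 u * g u + f 1 u = 0) ∧
  (∀ u ∈ U, -(deriv (deriv g) u) + deriv (f 2) u * g u
      + 3 * a * f 3 u * g u + f 2 u * deriv g u = 0) ∧
  (∀ k : ℕ, 3 ≤ k → k ≤ n - 1 → ∀ u ∈ U,
      deriv (f k) u * g u + ((k : ℝ) + 1) * a * f (k + 1) u * g u
        + ((k : ℝ) - 1) * f k u * deriv g u + (2 - (k : ℝ)) * f k u = 0)

/-- The auxiliary functions `A_k` in the case `F > 0` (so `ν = 1`); `A_n = 0` (empty sum). -/
noncomputable def AfunPos (n : ℕ) (a : ℝ) (b : ℕ → ℝ) (F : ℝ → ℝ) (k : ℕ) (u : ℝ) : ℝ :=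
  ∑ i ∈ Finset.Icc 1 (n - k),
    (-1 : ℝ) ^ i * ((k + i).choose i : ℝ) * a ^ i * b (k + i)
      * (F u) ^ (((i : ℝ) * ((n : ℝ) - 1)) / ((n : ℝ) - 2))

/-- The auxiliary functions `B_k` in the case `F > 0`. -/
noncomputable def BfunPos (n : ℕ) (a : ℝ) (b : ℕ → ℝ) (F : ℝ → ℝ) : ℕ → ℝ → ℝ
  | 0, u => AfunPos n a b F 0 u + a ^ 2 * (F u) ^ ((2 * ((n : ℝ) - 1)) / ((n : ℝ) - 2))
  | 1, u => AfunPos n a b F 1 u - a * (F u) ^ (((n : ℝ) - 1) / ((n : ℝ) - 2))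
  | k, u => AfunPos n a b F k u

/-- The truncated exponential-type polynomial `∑ (-a x)^i binom(k+i, i) b_{k+i}`, which solves the
recursive system `y_k' = -(k+1) a y_{k+1}`, `y_n = b_n`. -/
noncomputable def chainPoly (n : ℕ) (a : ℝ) (b : ℕ → ℝ) (k : ℕ) (x : ℝ) : ℝ :=
  ∑ i ∈ Finset.range (n - k + 1), (-1 : ℝ) ^ i * ((k + i).choose i : ℝ) * a ^ i * b (k + i) * x ^ i

theorem chainPoly_self (n : ℕ) (a : ℝ) (b : ℕ → ℝ) (x : ℝ) : chainPoly n a b n x = b n := by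
  simp [chainPoly]

theorem chainPoly_congr {n : ℕ} {a : ℝ} {b b' : ℕ → ℝ} {k : ℕ} (hk : k ≤ n)
    (h : ∀ j, k ≤ j → j ≤ n → b j = b' j) (x : ℝ) :
    chainPoly n a b k x = chainPoly n a b' k x := by
  refine Finset.sum_congr rfl fun i hi => ?_
  rw [Finset.mem_range] at hi
  rw [h (k + i) (by omega) (by omega)]

theorem chainPoly_eq_add (n : ℕ) (a : ℝ) (b : ℕ → ℝ) (k : ℕ) (x : ℝ) :
    chainPoly n a b k x = b k + ∑ i ∈ Finset.Icc 1 (n - k),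
      (-1 : ℝ) ^ i * ((k + i).choose i : ℝ) * a ^ i * b (k + i) * x ^ i := by
  rw [chainPoly, Finset.range_eq_Ico, Finset.sum_eq_sum_Ico_succ_bot (by omega)]
  simp only [pow_zero, Nat.add_zero, Nat.choose_zero_right, Nat.cast_one, mul_one, one_mul]
  rfl

theorem hasDerivAt_chainPoly {n k : ℕ} (hk : k < n) (a : ℝ) (b : ℕ → ℝ) (x : ℝ) :
    HasDerivAt (chainPoly n a b k) (-((k : ℝ) + 1) * a * chainPoly n a b (k + 1) x) x := by
  have key : HasDerivAt (chainPoly n a b k) (∑ i ∈ Finset.range (n - k + 1),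
      (-1 : ℝ) ^ i * ((k + i).choose i : ℝ) * a ^ i * b (k + i) * ((i : ℝ) * x ^ (i - 1))) x := by
    unfold chainPoly
    exact HasDerivAt.fun_sum fun i _ => (hasDerivAt_pow i x).const_mul _
  convert key using 1
  rw [Finset.sum_range_succ', chainPoly, Finset.mul_sum, show n - (k + 1) + 1 = n - k by omega]
  simp only [Nat.cast_zero, zero_mul, mul_zero, add_zero]
  refine Finset.sum_congr rfl fun i _ => ?_
  have hc : ((k : ℝ) + 1) * ((k + 1 + i).choose i : ℝ)
      = ((k + (i + 1)).choose (i + 1) : ℝ) * ((i : ℝ) + 1) := by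
    have h := Nat.choose_succ_right_eq (k + (i + 1)) i
    rw [show k + (i + 1) - i = k + 1 by omega] at h
    have h' : (((k + (i + 1)).choose (i + 1) * (i + 1) : ℕ) : ℝ)
        = (((k + (i + 1)).choose i * (k + 1) : ℕ) : ℝ) := by rw [h]
    push_cast at h'
    rw [h', show k + 1 + i = k + (i + 1) by omega]
    ring
  rw [show k + 1 + i = k + (i + 1) by omega] at hc ⊢
  rw [Nat.add_sub_cancel, pow_succ, pow_succ]
  push_cast
  linear_combination (-(-1 : ℝ) ^ i * a * a ^ i * b (k + (i + 1)) * x ^ i) * hc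

/-- Integration of the recursive system `φ_k' = -(k+1) a φ_{k+1} t'` on an interval. -/
theorem chain_system_iff {n : ℕ} {U : Set ℝ} (hU : IsOpen U) (hUc : U.OrdConnected) (a β : ℝ)
    {φ : ℕ → ℝ → ℝ} {t t' : ℝ → ℝ} (hφ : ∀ k ≤ n, ∀ u ∈ U, DifferentiableAt ℝ (φ k) u)
    (ht : ∀ u ∈ U, HasDerivAt t (t' u) u) (hn : ∀ u ∈ U, φ n u = β) :
    (∀ k < n, ∀ u ∈ U, deriv (φ k) u = -((k : ℝ) + 1) * a * φ (k + 1) u * t' u) ↔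
      ∃ b : ℕ → ℝ, b n = β ∧ ∀ k ≤ n, ∀ u ∈ U, φ k u = chainPoly n a b k (t u) := by
  constructor
  · intro h
    suffices H : ∀ j ≤ n, ∃ b : ℕ → ℝ, b n = β ∧
        ∀ k ≤ n, n ≤ k + j → ∀ u ∈ U, φ k u = chainPoly n a b k (t u) by
      obtain ⟨b, hb, hbk⟩ := H n le_rfl
      exact ⟨b, hb, fun k hk => hbk k hk (by omega)⟩
    intro j
    induction j with
    | zero =>
      refine fun _ => ⟨fun _ => β, rfl, fun k hk hk' u hu => ?_⟩
      obtain rfl : k = n := by omega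
      rw [chainPoly_self, hn u hu]
    | succ j ih =>
      intro hj
      obtain ⟨b, hb, hbk⟩ := ih (by omega)
      obtain ⟨m, hm⟩ : ∃ m, m + (j + 1) = n := ⟨n - (j + 1), by omega⟩
      have hmn : m < n := by omega
      have hder : ∀ u ∈ U, HasDerivAt (fun v => φ m v - chainPoly n a b m (t v)) 0 u := by
        intro u hu
        have h1 := (hφ m hmn.le u hu).hasDerivAt
        have h2 := (hasDerivAt_chainPoly hmn a b (t u)).comp u (ht u hu)
        refine (h1.sub h2).congr_deriv ?_
        rw [h m hmn u hu, hbk (m + 1) (by omega) (by omega) u hu, sub_self]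
      obtain ⟨d, hd⟩ := hU.exists_is_const_of_deriv_eq_zero hUc.isPreconnected
        (fun u hu => (hder u hu).differentiableAt.differentiableWithinAt)
        (fun u hu => (hder u hu).deriv)
      refine ⟨Function.update b m (b m + d), ?_, fun k hk hk' u hu => ?_⟩
      · rw [Function.update_of_ne (by omega), hb]
      · rcases Nat.lt_or_ge m k with hmk | hmk
        · rw [hbk k hk (by omega) u hu]
          exact chainPoly_congr hk (fun i hi _ => (Function.update_of_ne (by omega) _ _).symm) _
        · obtain rfl : k = m := by omega
          have hdu := hd u hu
          have hs : ∀ i ∈ Finset.Icc 1 (n - k), Function.update b k (b k + d) (k + i) = b (k + i) :=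
            fun i hi => Function.update_of_ne (by rw [Finset.mem_Icc] at hi; omega) _ _
          rw [chainPoly_eq_add] at hdu ⊢
          rw [Function.update_self, Finset.sum_congr rfl fun i hi => by rw [hs i hi]]
          linear_combination hdu
  · rintro ⟨b, -, hb⟩ k hk u hu
    have h1 : φ k =ᶠ[nhds u] fun v => chainPoly n a b k (t v) := by
      filter_upwards [hU.mem_nhds hu] with v hv using hb k hk.le v hv
    rw [h1.deriv_eq, hb (k + 1) hk u hu]
    exact ((hasDerivAt_chainPoly hk a b (t u)).comp u (ht u hu)).deriv

/-- The weight `w_k = c^(k-1) F^((k-n)/(n-2)) F'^(k-1)`, where `c = (n-1)/(n-2)`. -/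
noncomputable def weight (n : ℕ) (F : ℝ → ℝ) (k : ℕ) (u : ℝ) : ℝ :=
  (((n : ℝ) - 1) / ((n : ℝ) - 2)) ^ ((k : ℤ) - 1) * (F u) ^ (((k : ℝ) - (n : ℝ)) / ((n : ℝ) - 2))
    * (deriv F u) ^ ((k : ℤ) - 1)

/-- The part of `f_k` that does not involve the constants `b_j`. -/
noncomputable def inhom (n : ℕ) (a : ℝ) (F : ℝ → ℝ) : ℕ → ℝ → ℝ
  | 0, u => a ^ 2 * gFun n F u
  | 1, _ => -a
  | 2, u => deriv F u / F u - deriv (deriv F) u / deriv F u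
  | _ + 3, _ => 0

theorem weight_pos {n k : ℕ} (hn : 4 ≤ n) {F : ℝ → ℝ} {u : ℝ} (hF : 0 < F u)
    (hp : 0 < deriv F u) : 0 < weight n F k u := by
  have hn' : (4 : ℝ) ≤ n := by exact_mod_cast hn
  have : 0 < ((n : ℝ) - 1) / ((n : ℝ) - 2) := div_pos (by linarith) (by linarith)
  unfold weight
  positivity

theorem gFun_pos {n : ℕ} (hn : 4 ≤ n) {F : ℝ → ℝ} {u : ℝ} (hF : 0 < F u)
    (hp : 0 < deriv F u) : 0 < gFun n F u := by
  have hn' : (4 : ℝ) ≤ n := by exact_mod_cast hn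
  exact div_pos (mul_pos (by linarith) hF) (mul_pos (by linarith) hp)

theorem weight_succ_mul_gFun {n : ℕ} (k : ℕ) (hn : 4 ≤ n) {F : ℝ → ℝ} {u : ℝ} (hF : 0 < F u)
    (hp : 0 < deriv F u) : weight n F (k + 1) u * gFun n F u
      = weight n F k u * F u ^ (((n : ℝ) - 1) / ((n : ℝ) - 2)) := by
  have hn' : (4 : ℝ) ≤ n := by exact_mod_cast hn
  have h1 : (n : ℝ) - 1 ≠ 0 := by linarith
  have h2 : (n : ℝ) - 2 ≠ 0 := by linarith
  have hc : ((n : ℝ) - 1) / ((n : ℝ) - 2) ≠ 0 := div_ne_zero h1 h2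
  have hpow : F u ^ ((((k + 1 : ℕ) : ℝ) - n) / ((n : ℝ) - 2)) * F u
      = F u ^ (((k : ℝ) - n) / ((n : ℝ) - 2)) * F u ^ (((n : ℝ) - 1) / ((n : ℝ) - 2)) := by
    rw [← Real.rpow_add_one hF.ne', ← Real.rpow_add hF]
    congr 1
    push_cast
    field_simp
    ring
  have hz : ((k + 1 : ℕ) : ℤ) - 1 = ((k : ℤ) - 1) + 1 := by push_cast; ring
  have hg : gFun n F u
      = F u * ((((n : ℝ) - 1) / ((n : ℝ) - 2)) * deriv F u)⁻¹ := by
    unfold gFun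
    field_simp
  unfold weight
  rw [hg, hz, zpow_add_one₀ hc, zpow_add_one₀ hp.ne']
  generalize (((n : ℝ) - 1) / ((n : ℝ) - 2)) ^ ((k : ℤ) - 1) = C
  generalize deriv F u ^ ((k : ℤ) - 1) = P
  have hinv : ((n : ℝ) - 1) / ((n : ℝ) - 2) * deriv F u
      * (((n : ℝ) - 1) / ((n : ℝ) - 2) * deriv F u)⁻¹ = 1 :=
    mul_inv_cancel₀ (mul_ne_zero hc hp.ne')
  linear_combination C * P * hpow + (C * P * F u ^ ((((k + 1 : ℕ) : ℝ) - n) / ((n : ℝ) - 2)) * F u)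
    * hinv

theorem hasDerivAt_weight {n : ℕ} (k : ℕ) {F : ℝ → ℝ} {u : ℝ} (hF : 0 < F u)
    (hp : 0 < deriv F u) (hF₁ : DifferentiableAt ℝ F u) (hF₂ : DifferentiableAt ℝ (deriv F) u) :
    HasDerivAt (weight n F k) (weight n F k u * (((k : ℝ) - n) / ((n : ℝ) - 2) * (deriv F u / F u)
      + ((k : ℝ) - 1) * (deriv (deriv F) u / deriv F u))) u := by
  have h1 := hF₁.hasDerivAt.rpow_const (p := ((k : ℝ) - n) / ((n : ℝ) - 2)) (Or.inl hF.ne')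
  have h2 := (hasDerivAt_zpow ((k : ℤ) - 1) (deriv F u) (Or.inl hp.ne')).comp u hF₂.hasDerivAt
  refine ((h1.const_mul ((((n : ℝ) - 1) / ((n : ℝ) - 2)) ^ ((k : ℤ) - 1))).mul h2).congr_deriv ?_
  rw [Real.rpow_sub_one hF.ne', zpow_sub_one₀ hp.ne']
  simp only [weight, Function.comp]
  push_cast
  ring

theorem hasDerivAt_gFun {n : ℕ} (hn : 4 ≤ n) {F : ℝ → ℝ} {u : ℝ}
    (hp : 0 < deriv F u) (hF₁ : DifferentiableAt ℝ F u) (hF₂ : DifferentiableAt ℝ (deriv F) u) :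
    HasDerivAt (gFun n F) (((n : ℝ) - 2) / ((n : ℝ) - 1)
      * (1 - F u * deriv (deriv F) u / deriv F u ^ 2)) u := by
  have hn' : (4 : ℝ) ≤ n := by exact_mod_cast hn
  have h1 : (n : ℝ) - 1 ≠ 0 := by linarith
  have hp' := hp.ne'
  refine ((hF₁.hasDerivAt.const_mul ((n : ℝ) - 2)).div
    (hF₂.hasDerivAt.const_mul ((n : ℝ) - 1)) (mul_ne_zero h1 hp')).congr_deriv ?_
  field_simp

theorem hasDerivAt_inhom_two {n : ℕ} (a : ℝ) {F : ℝ → ℝ} {u : ℝ} (hF : 0 < F u)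
    (hp : 0 < deriv F u) (hF₁ : DifferentiableAt ℝ F u) (hF₂ : DifferentiableAt ℝ (deriv F) u)
    (hF₃ : DifferentiableAt ℝ (deriv (deriv F)) u) :
    HasDerivAt (inhom n a F 2) ((deriv (deriv F) u * F u - deriv F u * deriv F u) / F u ^ 2
      - (deriv (deriv (deriv F)) u * deriv F u - deriv (deriv F) u * deriv (deriv F) u)
        / deriv F u ^ 2) u :=
  (hF₂.hasDerivAt.div hF₁.hasDerivAt hF.ne').sub (hF₃.hasDerivAt.div hF₂.hasDerivAt hp.ne')

theorem differentiableAt_inhom {n : ℕ} (hn : 4 ≤ n) (a : ℝ) (k : ℕ) {F : ℝ → ℝ} {u : ℝ}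
    (hF : 0 < F u)
    (hp : 0 < deriv F u) (hF₁ : DifferentiableAt ℝ F u) (hF₂ : DifferentiableAt ℝ (deriv F) u)
    (hF₃ : DifferentiableAt ℝ (deriv (deriv F)) u) : DifferentiableAt ℝ (inhom n a F k) u :=
  match k with
  | 0 => ((hasDerivAt_gFun hn hp hF₁ hF₂).const_mul (a ^ 2)).differentiableAt
  | 1 => differentiableAt_const (-a)
  | 2 => (hasDerivAt_inhom_two a hF hp hF₁ hF₂ hF₃).differentiableAt
  | _ + 3 => differentiableAt_const (0 : ℝ)

/-- The common differential expression on the left of all the equations of the system. -/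
theorem operator_eq {n : ℕ} (hn : 4 ≤ n) (a : ℝ) (k : ℕ) {f : ℕ → ℝ → ℝ} {F : ℝ → ℝ} {u : ℝ}
    (hf : DifferentiableAt ℝ (f k) u) (hF : 0 < F u) (hp : 0 < deriv F u)
    (hF₁ : DifferentiableAt ℝ F u) (hF₂ : DifferentiableAt ℝ (deriv F) u)
    (hF₃ : DifferentiableAt ℝ (deriv (deriv F)) u) :
    deriv (f k) u * gFun n F u + ((k : ℝ) + 1) * a * f (k + 1) u * gFun n F u
        + ((k : ℝ) - 1) * f k u * deriv (gFun n F) u + (2 - (k : ℝ)) * f k u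
      = weight n F k u * gFun n F u * (deriv (fun v => (f k v - inhom n a F k v) / weight n F k v) u
          + ((k : ℝ) + 1) * a * ((f (k + 1) u - inhom n a F (k + 1) u) / weight n F (k + 1) u)
            * (F u ^ (((n : ℝ) - 1) / ((n : ℝ) - 2)) / gFun n F u))
        + (deriv (inhom n a F k) u * gFun n F u
          + ((k : ℝ) + 1) * a * inhom n a F (k + 1) u * gFun n F u
          + ((k : ℝ) - 1) * inhom n a F k u * deriv (gFun n F) u
          + (2 - (k : ℝ)) * inhom n a F k u) := by
  have hn' : (4 : ℝ) ≤ n := by exact_mod_cast hn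
  have h1 : (n : ℝ) - 1 ≠ 0 := by linarith
  have h2 : (n : ℝ) - 2 ≠ 0 := by linarith
  have hw := (weight_pos (k := k) hn hF hp).ne'
  have hw' := (weight_pos (k := k + 1) hn hF hp).ne'
  have hg := (gFun_pos hn hF hp).ne'
  have hws := weight_succ_mul_gFun k hn hF hp
  have hd := ((hf.hasDerivAt.sub
    (differentiableAt_inhom hn a k hF hp hF₁ hF₂ hF₃).hasDerivAt).div
      (hasDerivAt_weight (n := n) k hF hp hF₁ hF₂) hw).deriv
  have hnext : weight n F k u * gFun n F u * (((k : ℝ) + 1) * a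
      * ((f (k + 1) u - inhom n a F (k + 1) u) / weight n F (k + 1) u)
      * (F u ^ (((n : ℝ) - 1) / ((n : ℝ) - 2)) / gFun n F u))
      = ((k : ℝ) + 1) * a * (f (k + 1) u - inhom n a F (k + 1) u) * gFun n F u := by
    field_simp
    linear_combination (-(a * (f (k + 1) u - inhom n a F (k + 1) u))) * hws
  have hcoef : (((k : ℝ) - n) / ((n : ℝ) - 2) * (deriv F u / F u)
      + ((k : ℝ) - 1) * (deriv (deriv F) u / deriv F u)) * gFun n F u
      = -(((k : ℝ) - 1) * deriv (gFun n F) u + (2 - (k : ℝ))) := by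
    rw [(hasDerivAt_gFun hn hp hF₁ hF₂).deriv, gFun]
    have hF' := hF.ne'
    have hp' := hp.ne'
    field_simp
    ring
  have hder : weight n F k u * gFun n F u *
      deriv (fun v => (f k v - inhom n a F k v) / weight n F k v) u
      = (deriv (f k) u - deriv (inhom n a F k) u) * gFun n F u
        + (f k u - inhom n a F k u) * (((k : ℝ) - 1) * deriv (gFun n F) u + (2 - (k : ℝ))) := by
    have hd' : deriv (fun v => (f k v - inhom n a F k v) / weight n F k v) u = _ := hd
    rw [hd']
    simp only [Pi.sub_apply]
    generalize (((k : ℝ) - n) / ((n : ℝ) - 2) * (deriv F u / F u)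
      + ((k : ℝ) - 1) * (deriv (deriv F) u / deriv F u)) = q at hcoef
    field_simp
    linear_combination (-(f k u - inhom n a F k u)) * hcoef
  rw [mul_add, hnext, hder]
  ring

theorem deriv_gFun_eq_inhom_two_mul {n : ℕ} (hn : 4 ≤ n) (a : ℝ) {F : ℝ → ℝ} {u : ℝ}
    (hF : 0 < F u) (hp : 0 < deriv F u) (hF₁ : DifferentiableAt ℝ F u)
    (hF₂ : DifferentiableAt ℝ (deriv F) u) :
    deriv (gFun n F) u = inhom n a F 2 u * gFun n F u := by
  have hn' : (4 : ℝ) ≤ n := by exact_mod_cast hn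
  have h1 : (n : ℝ) - 1 ≠ 0 := by linarith
  have hF' := hF.ne'
  have hp' := hp.ne'
  rw [(hasDerivAt_gFun hn hp hF₁ hF₂).deriv, inhom, gFun]
  field_simp

theorem deriv_deriv_gFun {n : ℕ} (hn : 4 ≤ n) (a : ℝ) {U : Set ℝ} (hU : IsOpen U) {F : ℝ → ℝ}
    (hF₁ : ∀ u ∈ U, DifferentiableAt ℝ F u) (hF₂ : ∀ u ∈ U, DifferentiableAt ℝ (deriv F) u)
    (hF₃ : ∀ u ∈ U, DifferentiableAt ℝ (deriv (deriv F)) u)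
    (hF : ∀ u ∈ U, 0 < F u) (hp : ∀ u ∈ U, 0 < deriv F u) {u : ℝ} (hu : u ∈ U) :
    deriv (deriv (gFun n F)) u
      = deriv (inhom n a F 2) u * gFun n F u + inhom n a F 2 u * deriv (gFun n F) u := by
  have hev : deriv (gFun n F) =ᶠ[nhds u] fun v => inhom n a F 2 v * gFun n F v := by
    filter_upwards [hU.mem_nhds hu] with v hv
    exact deriv_gFun_eq_inhom_two_mul hn a (hF v hv) (hp v hv) (hF₁ v hv) (hF₂ v hv)
  rw [hev.deriv_eq]
  exact ((differentiableAt_inhom hn a 2 (hF u hu) (hp u hu) (hF₁ u hu) (hF₂ u hu)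
    (hF₃ u hu)).hasDerivAt.mul (hasDerivAt_gFun hn (hp u hu) (hF₁ u hu)
      (hF₂ u hu)).differentiableAt.hasDerivAt).deriv

theorem Esys_gFun_iff {n : ℕ} (hn : 4 ≤ n) (a : ℝ) {U : Set ℝ} (hU : IsOpen U)
    {f : ℕ → ℝ → ℝ} {F : ℝ → ℝ} (hf : ∀ k ≤ n, ∀ u ∈ U, DifferentiableAt ℝ (f k) u)
    (hF₁ : ∀ u ∈ U, DifferentiableAt ℝ F u) (hF₂ : ∀ u ∈ U, DifferentiableAt ℝ (deriv F) u)
    (hF₃ : ∀ u ∈ U, DifferentiableAt ℝ (deriv (deriv F)) u)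
    (hF : ∀ u ∈ U, 0 < F u) (hp : ∀ u ∈ U, 0 < deriv F u) :
    Esys n f a U (gFun n F) ↔ ∀ k < n, ∀ u ∈ U,
      deriv (fun v => (f k v - inhom n a F k v) / weight n F k v) u
        = -((k : ℝ) + 1) * a * ((f (k + 1) u - inhom n a F (k + 1) u) / weight n F (k + 1) u)
          * (F u ^ (((n : ℝ) - 1) / ((n : ℝ) - 2)) / gFun n F u) := by
  have key : ∀ k < n, ∀ u ∈ U, ∀ E : ℝ,
      E = deriv (f k) u * gFun n F u + ((k : ℝ) + 1) * a * f (k + 1) u * gFun n F u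
        + ((k : ℝ) - 1) * f k u * deriv (gFun n F) u + (2 - (k : ℝ)) * f k u
        - (deriv (inhom n a F k) u * gFun n F u
          + ((k : ℝ) + 1) * a * inhom n a F (k + 1) u * gFun n F u
          + ((k : ℝ) - 1) * inhom n a F k u * deriv (gFun n F) u
          + (2 - (k : ℝ)) * inhom n a F k u) →
      (E = 0 ↔ deriv (fun v => (f k v - inhom n a F k v) / weight n F k v) u
        = -((k : ℝ) + 1) * a * ((f (k + 1) u - inhom n a F (k + 1) u) / weight n F (k + 1) u)
          * (F u ^ (((n : ℝ) - 1) / ((n : ℝ) - 2)) / gFun n F u)) := by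
    intro k hk u hu E hE
    rw [hE, operator_eq hn a k (hf k hk.le u hu) (hF u hu) (hp u hu) (hF₁ u hu) (hF₂ u hu)
      (hF₃ u hu), add_sub_cancel_right, mul_eq_zero, or_iff_right
      (mul_pos (weight_pos hn (hF u hu) (hp u hu)) (gFun_pos hn (hF u hu) (hp u hu))).ne',
      add_eq_zero_iff_eq_neg]
    refine Eq.congr_right ?_
    ring
  have e0 : ∀ u ∈ U, deriv (inhom n a F 0) u = a ^ 2 * deriv (gFun n F) u := fun u hu =>
    ((hasDerivAt_gFun hn (hp u hu) (hF₁ u hu)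
      (hF₂ u hu)).differentiableAt.hasDerivAt.const_mul (a ^ 2)).deriv
  have e1 : ∀ u, deriv (inhom n a F 1) u = 0 := fun u => deriv_const u (-a)
  have e3 : ∀ k u, deriv (inhom n a F (k + 3)) u = 0 := fun k u => deriv_const u (0 : ℝ)
  have k0 := fun u hu => key 0 (by omega) u hu (-a ^ 2 * gFun n F u + deriv (f 0) u * gFun n F u
    + a * f 1 u * gFun n F u - f 0 u * deriv (gFun n F) u + 2 * f 0 u) (by
      rw [e0 u hu]; simp only [inhom]; push_cast; ring)
  have k1 := fun u hu => key 1 (by omega) u hu (a * (1 - 2 * deriv (gFun n F) u)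
    + deriv (f 1) u * gFun n F u + 2 * a * f 2 u * gFun n F u + f 1 u) (by
      rw [e1 u, deriv_gFun_eq_inhom_two_mul hn a (hF u hu) (hp u hu) (hF₁ u hu) (hF₂ u hu)]
      simp only [inhom]; push_cast; ring)
  have k2 := fun u hu => key 2 (by omega) u hu (-(deriv (deriv (gFun n F)) u)
    + deriv (f 2) u * gFun n F u + 3 * a * f 3 u * gFun n F u + f 2 u * deriv (gFun n F) u) (by
      rw [deriv_deriv_gFun hn a hU hF₁ hF₂ hF₃ hF hp hu]; simp only [inhom]; push_cast; ring)
  have k3 := fun k (hk : k + 3 < n) u hu => key (k + 3) hk u hu (deriv (f (k + 3)) u * gFun n F u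
    + (((k + 3 : ℕ) : ℝ) + 1) * a * f (k + 3 + 1) u * gFun n F u
    + (((k + 3 : ℕ) : ℝ) - 1) * f (k + 3) u * deriv (gFun n F) u
    + (2 - ((k + 3 : ℕ) : ℝ)) * f (k + 3) u) (by rw [e3 k u]; simp only [inhom]; ring)
  constructor
  · rintro ⟨h0, h1, h2, h3⟩ k hk u hu
    match k, hk with
    | 0, _ => exact (k0 u hu).1 (h0 u hu)
    | 1, _ => exact (k1 u hu).1 (h1 u hu)
    | 2, _ => exact (k2 u hu).1 (h2 u hu)
    | k + 3, hk => exact (k3 k hk u hu).1 (h3 (k + 3) (by omega) (by omega) u hu)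
  · intro h
    refine ⟨fun u hu => (k0 u hu).2 (h 0 (by omega) u hu), fun u hu => (k1 u hu).2
      (h 1 (by omega) u hu), fun u hu => (k2 u hu).2 (h 2 (by omega) u hu),
      fun k hk hkn u hu => ?_⟩
    obtain ⟨k, rfl⟩ : ∃ j, k = j + 3 := ⟨k - 3, by omega⟩
    exact (k3 k (by omega) u hu).2 (h (k + 3) (by omega) u hu)

theorem chainPoly_rpow_eq (n : ℕ) (a : ℝ) (b : ℕ → ℝ) (k : ℕ) {F : ℝ → ℝ} {u : ℝ}
    (hF : 0 < F u) :
    chainPoly n a b k (F u ^ (((n : ℝ) - 1) / ((n : ℝ) - 2))) = b k + AfunPos n a b F k u := by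
  rw [chainPoly_eq_add, AfunPos]
  congr 1
  refine Finset.sum_congr rfl fun i _ => ?_
  rw [← Real.rpow_mul_natCast hF.le, mul_comm (((n : ℝ) - 1) / ((n : ℝ) - 2)), mul_div_assoc]

theorem weight_two {n : ℕ} (hn : 4 ≤ n) (F : ℝ → ℝ) (u : ℝ) :
    weight n F 2 u = ((n : ℝ) - 1) / ((n : ℝ) - 2) * (deriv F u / F u) := by
  have hn' : (4 : ℝ) ≤ n := by exact_mod_cast hn
  have h2 : (n : ℝ) - 2 ≠ 0 := by linarith
  have he : (((2 : ℕ) : ℝ) - n) / ((n : ℝ) - 2) = -1 := by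
    push_cast
    field_simp
    ring
  rw [weight, he, Real.rpow_neg_one]
  norm_num
  ring

theorem rpow_mul_weight_one {n : ℕ} (hn : 4 ≤ n) {F : ℝ → ℝ} {u : ℝ} (hF : 0 < F u) :
    F u ^ (((n : ℝ) - 1) / ((n : ℝ) - 2)) * weight n F 1 u = 1 := by
  have hn' : (4 : ℝ) ≤ n := by exact_mod_cast hn
  have h2 : (n : ℝ) - 2 ≠ 0 := by linarith
  simp only [weight, Nat.cast_one, sub_self, zpow_zero, one_mul, mul_one]
  rw [← Real.rpow_add hF, ← add_div, show (n : ℝ) - 1 + (1 - n) = 0 by ring, zero_div,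
    Real.rpow_zero]

theorem rpow_mul_weight_zero {n : ℕ} (hn : 4 ≤ n) {F : ℝ → ℝ} {u : ℝ} (hF : 0 < F u)
    (hp : 0 < deriv F u) :
    F u ^ ((2 * ((n : ℝ) - 1)) / ((n : ℝ) - 2)) * weight n F 0 u = gFun n F u := by
  have h := weight_succ_mul_gFun 0 hn hF hp
  have h' := rpow_mul_weight_one hn hF
  rw [mul_div_assoc, two_mul, Real.rpow_add hF]
  linear_combination (-F u ^ (((n : ℝ) - 1) / ((n : ℝ) - 2))) * h + gFun n F u * h'

theorem chainPoly_mul_weight_add_inhom {n : ℕ} (hn : 4 ≤ n) (a : ℝ) (b : ℕ → ℝ) (k : ℕ)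
    (hk : k ≠ 2) {F : ℝ → ℝ} {u : ℝ} (hF : 0 < F u) (hp : 0 < deriv F u) :
    chainPoly n a b k (F u ^ (((n : ℝ) - 1) / ((n : ℝ) - 2))) * weight n F k u + inhom n a F k u
      = (b k + BfunPos n a b F k u) * weight n F k u := by
  rw [chainPoly_rpow_eq n a b k hF]
  match k, hk with
  | 0, _ =>
    simp only [inhom, BfunPos]
    linear_combination (-a ^ 2) * rpow_mul_weight_zero hn hF hp
  | 1, _ =>
    simp only [inhom, BfunPos]
    linear_combination a * rpow_mul_weight_one hn hF
  | k + 3, _ => simp [inhom, BfunPos]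

theorem stmt11 (n : ℕ) (hn : 4 ≤ n)
    (U : Set ℝ) (hU : IsOpen U) (hUc : U.OrdConnected)
    (f : ℕ → ℝ → ℝ) (hf : ∀ k ≤ n, ∀ u ∈ U, DifferentiableAt ℝ (f k) u)
    (F : ℝ → ℝ)
    (hF₁ : ∀ u ∈ U, DifferentiableAt ℝ F u)
    (hF₂ : ∀ u ∈ U, DifferentiableAt ℝ (deriv F) u)
    (hF₃ : ∀ u ∈ U, DifferentiableAt ℝ (deriv (deriv F)) u)
    (hfn : ∀ u ∈ U, f n u ≠ 0)
    (hFpos : ∀ u ∈ U, 0 < F u)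
    (hF' : ∀ u ∈ U, deriv F u = |f n u| ^ ((1 : ℝ) / ((n : ℝ) - 1)))
    (ε : ℝ) (hε : ε = 1 ∨ ε = -1)
    (hεf : ∀ u ∈ U, |f n u| = ε * f n u)
    (a : ℝ) :
    Esys n f a U (gFun n F) ↔
      ∃ b : ℕ → ℝ,
        b n = ε * ((((n : ℝ) - 1) / ((n : ℝ) - 2)) ^ ((1 : ℤ) - (n : ℤ))) ∧
        (∀ k ≤ n, k ≠ 2 → ∀ u ∈ U,
          f k u = (b k + BfunPos n a b F k u) * (((n : ℝ) - 1) / ((n : ℝ) - 2)) ^ ((k : ℤ) - 1)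
            * (F u) ^ ((((k : ℝ) - (n : ℝ)) / ((n : ℝ) - 2)))
            * (deriv F u) ^ ((k : ℤ) - 1)) ∧
        (∀ u ∈ U,
          f 2 u = (b 2 + BfunPos n a b F 2 u) * (((n : ℝ) - 1) / ((n : ℝ) - 2))
              * (deriv F u / F u)
            + deriv F u / F u - deriv (deriv F) u / deriv F u) := by
  have hn' : (4 : ℝ) ≤ n := by exact_mod_cast hn
  have h1 : (n : ℝ) - 1 ≠ 0 := by linarith
  have h2 : (n : ℝ) - 2 ≠ 0 := by linarith
  have hp : ∀ u ∈ U, 0 < deriv F u := fun u hu => by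
    rw [hF' u hu]
    exact Real.rpow_pos_of_pos (abs_pos.2 (hfn u hu)) _
  have hw : ∀ k, ∀ u ∈ U, weight n F k u ≠ 0 := fun k u hu =>
    (weight_pos hn (hFpos u hu) (hp u hu)).ne'
  have htop : ∀ u ∈ U, (f n u - inhom n a F n u) / weight n F n u
      = ε * ((((n : ℝ) - 1) / ((n : ℝ) - 2)) ^ ((1 : ℤ) - (n : ℤ))) := by
    intro u hu
    have he : inhom n a F n u = 0 := by
      obtain ⟨m, rfl⟩ : ∃ m, n = m + 3 := ⟨n - 3, by omega⟩
      rfl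
    have hpow : deriv F u ^ ((n : ℤ) - 1) = ε * f n u := by
      rw [← hεf u hu, hF' u hu, ← Real.rpow_intCast, ← Real.rpow_mul (abs_nonneg _)]
      push_cast
      rw [one_div_mul_cancel h1, Real.rpow_one]
    have hεε : ε * ε = 1 := by rcases hε with rfl | rfl <;> norm_num
    have hc : (((n : ℝ) - 1) / ((n : ℝ) - 2)) ^ ((1 : ℤ) - (n : ℤ))
        * (((n : ℝ) - 1) / ((n : ℝ) - 2)) ^ ((n : ℤ) - 1) = 1 := by
      rw [← zpow_add₀ (div_ne_zero h1 h2)]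
      simp
    rw [div_eq_iff (hw n u hu), he, weight, hpow, sub_self, zero_div, Real.rpow_zero]
    linear_combination (-f n u * ε * ε) * hc - f n u * hεε
  have ht : ∀ u ∈ U, HasDerivAt (fun v => F v ^ (((n : ℝ) - 1) / ((n : ℝ) - 2)))
      (F u ^ (((n : ℝ) - 1) / ((n : ℝ) - 2)) / gFun n F u) u := by
    intro u hu
    have hF0 := (hFpos u hu).ne'
    have hp0 := (hp u hu).ne'
    refine ((hF₁ u hu).hasDerivAt.rpow_const (Or.inl hF0)).congr_deriv ?_
    rw [Real.rpow_sub_one hF0, gFun]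
    field_simp
  rw [Esys_gFun_iff hn a hU hf hF₁ hF₂ hF₃ hFpos hp,
    chain_system_iff hU hUc a _
      (φ := fun k v => (f k v - inhom n a F k v) / weight n F k v)
      (fun k hk u hu => ((hf k hk u hu).sub (differentiableAt_inhom hn a k (hFpos u hu) (hp u hu)
        (hF₁ u hu) (hF₂ u hu) (hF₃ u hu))).div (hasDerivAt_weight k (hFpos u hu) (hp u hu)
          (hF₁ u hu) (hF₂ u hu)).differentiableAt (hw k u hu)) ht htop]
  refine exists_congr fun b => and_congr_right fun _ => ?_
  have hgen : ∀ k, k ≠ 2 → ∀ u ∈ U, ((f k u - inhom n a F k u) / weight n F k u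
      = chainPoly n a b k (F u ^ (((n : ℝ) - 1) / ((n : ℝ) - 2))) ↔
      f k u = (b k + BfunPos n a b F k u) * (((n : ℝ) - 1) / ((n : ℝ) - 2)) ^ ((k : ℤ) - 1)
            * (F u) ^ ((((k : ℝ) - (n : ℝ)) / ((n : ℝ) - 2)))
            * (deriv F u) ^ ((k : ℤ) - 1)) := by
    intro k hk u hu
    rw [div_eq_iff (hw k u hu), sub_eq_iff_eq_add,
      chainPoly_mul_weight_add_inhom hn a b k hk (hFpos u hu) (hp u hu), weight]
    simp only [mul_assoc]
  have htwo : ∀ u ∈ U, ((f 2 u - inhom n a F 2 u) / weight n F 2 u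
      = chainPoly n a b 2 (F u ^ (((n : ℝ) - 1) / ((n : ℝ) - 2))) ↔
      f 2 u = (b 2 + BfunPos n a b F 2 u) * (((n : ℝ) - 1) / ((n : ℝ) - 2))
              * (deriv F u / F u)
            + deriv F u / F u - deriv (deriv F) u / deriv F u) := by
    intro u hu
    rw [div_eq_iff (hw 2 u hu), sub_eq_iff_eq_add, chainPoly_rpow_eq n a b 2 (hFpos u hu),
      weight_two hn]
    simp only [inhom, BfunPos]
    rw [mul_assoc, add_sub_assoc]
  constructor
  · intro h
    exact ⟨fun k hk hk2 u hu => (hgen k hk2 u hu).1 (h k hk u hu),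
      fun u hu => (htwo u hu).1 (h 2 (by omega) u hu)⟩
  · rintro ⟨h, h'⟩ k hk u hu
    by_cases hk2 : k = 2
    · subst hk2
      exact (htwo u hu).2 (h' u hu)
    · exact (hgen k hk2 u hu).2 (h k hk hk2 u hu)
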